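/- There exists a constant C > 0, depending only on H, such that for every multiplier M on H there exists a sequence (φ_n)_{n∈ℕ} ⊆ C_c(ℝ) with: (i) for every f ∈ H, ‖M_{φ_n} f − M f‖_H → 0 as n → ∞; and (ii) ‖M_{φ_n}‖ ≤ C ‖M‖ for every n. -/

import Mathlib

open MeasureTheory Complex Real Filter Topology

noncomputable section

/-- A Hilbert space `H` of (locally integrable) functions on `ℝ` satisfying the
hypotheses (H1)-(H4) of the paper. -/
structure MultiplierSetup (H : Type) [NormedAddCommGroup H]
    [InnerProductSpace ℂ H] [CompleteSpace H] where
  /-- the inclusion of `H` into (a.e. classes of) functions on `ℝ` -/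
  ι : H →ₗ[ℂ] (ℝ →ₘ[volume] ℂ)
  ι_inj : Function.Injective ι
  /-- `H ⊆ L¹_loc(ℝ)` -/
  locInt : ∀ f : H, LocallyIntegrable (ι f) volume
  /-- `C_c(ℝ) ⊆ H` -/
  ofCc : CompactlySupportedContinuousMap ℝ ℂ → H
  ofCc_spec : ∀ φ : CompactlySupportedContinuousMap ℝ ℂ,
    (ι (ofCc φ) : ℝ → ℂ) =ᵐ[volume] φ
  /-- `C_c(ℝ)` is dense in `H` -/
  ofCc_dense : DenseRange ofCc
  /-- (H1): both inclusions are continuous -/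
  incl_cont : ∀ K : Set ℝ, IsCompact K → ∃ c > 0,
    (∀ φ : CompactlySupportedContinuousMap ℝ ℂ, tsupport (φ : ℝ → ℂ) ⊆ K →
      ‖ofCc φ‖ ≤ c * ⨆ x, ‖φ x‖) ∧
    (∀ f : H, (∫ x in K, ‖(ι f : ℝ → ℂ) x‖) ≤ c * ‖f‖)
  /-- (H2): the translation group acting boundedly on `H` -/
  S : ℝ → H →L[ℂ] H
  S_spec : ∀ (x : ℝ) (f : H), ((ι (S x f)) : ℝ → ℂ) =ᵐ[volume]
    fun y => (ι f : ℝ → ℂ) (y - x)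
  S_add : ∀ x y : ℝ, (S x).comp (S y) = S (x + y)
  S_zero : S 0 = 1
  S_loc_bdd : ∀ K : Set ℝ, IsCompact K → ∃ C : ℝ, ∀ x ∈ K, ‖S x‖ ≤ C
  /-- (H3): the modulations act on `H`, uniformly boundedly -/
  T : ℝ → H →L[ℂ] H
  T_spec : ∀ (α : ℝ) (f : H), ((ι (T α f)) : ℝ → ℂ) =ᵐ[volume]
    fun x => Complex.exp (Complex.I * α * x) * (ι f : ℝ → ℂ) x
  T_bdd : ∃ C : ℝ, ∀ α : ℝ, ‖T α‖ ≤ C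
  /-- (H4): exponential bound on the norms of the translations -/
  S_exp : ∃ C > 0, ∃ a ≥ 0, ∀ x : ℝ, ‖S x‖ ≤ C * Real.exp (a * |x|)

lemma continuous_apply_of_dense {H : Type*} [NormedAddCommGroup H] [NormedSpace ℂ H]
    {A : ℝ → H →L[ℂ] H} {D : Set H} (hD : Dense D)
    (hbdd : ∀ t₀, ∃ C : ℝ, ∀ᶠ t in 𝓝 t₀, ‖A t‖ ≤ C)
    (hA : ∀ g ∈ D, Continuous fun t => A t g) (f : H) : Continuous fun t => A t f := by
  rw [continuous_iff_continuousAt]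
  intro t₀
  obtain ⟨C, hC⟩ := hbdd t₀
  have hC0 : 0 ≤ C := (norm_nonneg _).trans hC.self_of_nhds
  rw [Metric.continuousAt_iff']
  intro ε hε
  obtain ⟨g, hgD, hg⟩ := hD.exists_dist_lt f (show 0 < ε / (3 * (C + 1)) by positivity)
  have hgc := Metric.continuousAt_iff'.1 ((hA g hgD).continuousAt (x := t₀)) (ε / 3) (by positivity)
  have key : ∀ t, ‖A t‖ ≤ C → dist (A t f) (A t g) < ε / 3 := by
    intro t ht
    rw [dist_eq_norm, ← map_sub]
    rw [dist_eq_norm] at hg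
    calc _ ≤ ‖A t‖ * ‖f - g‖ := (A t).le_opNorm _
      _ ≤ (C + 1) * ‖f - g‖ := by gcongr; linarith
      _ < (C + 1) * (ε / (3 * (C + 1))) := by gcongr
      _ = ε / 3 := by field_simp
  filter_upwards [hC, hgc] with t ht htg
  have h1 := key t ht
  have h2 := key t₀ hC.self_of_nhds
  have := dist_triangle4_right (A t f) (A t₀ f) (A t g) (A t₀ g)
  linarith

lemma tendsto_apply_of_bounded {H : Type*} [NormedAddCommGroup H] [NormedSpace ℂ H]
    {ι' : Type*} {l : Filter ι'} {A : ι' → H →L[ℂ] H} {C : ℝ}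
    (hA : ∀ i, ‖A i‖ ≤ C) {u : ι' → H} {g b : H} (hu : Tendsto u l (𝓝 g))
    (hg : Tendsto (fun i => A i g) l (𝓝 b)) : Tendsto (fun i => A i (u i)) l (𝓝 b) := by
  have h0 : Tendsto (fun i => A i (u i - g)) l (𝓝 0) := by
    refine squeeze_zero_norm (fun i => (A i).le_of_opNorm_le (hA i) _) ?_
    simpa using (tendsto_iff_norm_sub_tendsto_zero.1 hu).const_mul C
  simpa using h0.add hg

namespace MultiplierSetup

variable {H : Type} [NormedAddCommGroup H] [InnerProductSpace ℂ H] [CompleteSpace H]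
  (P : MultiplierSetup H)

lemma ext_ae {f g : H} (h : (P.ι f : ℝ → ℂ) =ᵐ[volume] P.ι g) : f = g :=
  P.ι_inj (AEEqFun.ext h)

lemma eq_ofCc {f : H} {φ : CompactlySupportedContinuousMap ℝ ℂ}
    (h : (P.ι f : ℝ → ℂ) =ᵐ[volume] φ) : f = P.ofCc φ :=
  P.ext_ae (h.trans (P.ofCc_spec φ).symm)

lemma ofCc_sub (φ ψ : CompactlySupportedContinuousMap ℝ ℂ) :
    P.ofCc (φ - ψ) = P.ofCc φ - P.ofCc ψ := by
  symm
  apply P.eq_ofCc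
  rw [map_sub]
  filter_upwards [AEEqFun.coeFn_sub (P.ι (P.ofCc φ)) (P.ι (P.ofCc ψ)), P.ofCc_spec φ,
    P.ofCc_spec ψ] with x h1 h2 h3
  simp [h1, h2, h3]

lemma continuousAt_ofCc {Φ : ℝ → CompactlySupportedContinuousMap ℝ ℂ} {t₀ : ℝ}
    (hΦ : Continuous (Function.uncurry fun t y => Φ t y)) {K : Set ℝ} (hK : IsCompact K)
    (hsupp : ∀ᶠ t in 𝓝 t₀, Function.support (Φ t) ⊆ K) :
    ContinuousAt (fun t => P.ofCc (Φ t)) t₀ := by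
  obtain ⟨c, hc, hcK, -⟩ := P.incl_cont K hK
  rw [Metric.continuousAt_iff']
  intro ε hε
  obtain ⟨v, hv, hvK⟩ := hK.mem_uniformity_of_prod (f := fun t y => Φ t y) (s := Set.univ)
    hΦ.continuousOn (Set.mem_univ t₀) (Metric.dist_mem_uniformity (half_pos (div_pos hε hc)))
  rw [nhdsWithin_univ] at hv
  have h0 := hsupp.self_of_nhds
  filter_upwards [hv, hsupp] with t ht hts
  have hbound : ∀ y, ‖(Φ t - Φ t₀) y‖ ≤ ε / c / 2 := by
    intro y
    by_cases hy : y ∈ K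
    · have := hvK t ht y hy
      rw [Set.mem_ofPred_eq, dist_eq_norm] at this
      exact this.le
    · have h1 : Φ t y = 0 := by by_contra h; exact hy (hts h)
      have h2 : Φ t₀ y = 0 := by by_contra h; exact hy (h0 h)
      simp only [CompactlySupportedContinuousMap.coe_sub, Pi.sub_apply, h1, h2, sub_zero, norm_zero]
      positivity
  have hsub : tsupport (Φ t - Φ t₀ : CompactlySupportedContinuousMap ℝ ℂ) ⊆ K := by
    refine closure_minimal ?_ hK.isClosed
    rw [CompactlySupportedContinuousMap.coe_sub]
    exact (Function.support_sub _ _).trans (Set.union_subset hts h0)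
  rw [dist_eq_norm, ← P.ofCc_sub]
  calc _ ≤ c * ⨆ y, ‖(Φ t - Φ t₀) y‖ := hcK _ hsub
    _ ≤ c * (ε / c / 2) := by gcongr; exact ciSup_le hbound
    _ = ε / 2 := by field_simp
    _ < ε := half_lt_self hε

/-- The translate `φ(· - x)` of a compactly supported function. -/
def translate (φ : CompactlySupportedContinuousMap ℝ ℂ) (x : ℝ) :
    CompactlySupportedContinuousMap ℝ ℂ where
  toFun y := φ (y - x)
  continuous_toFun := by fun_prop
  hasCompactSupport' := φ.hasCompactSupport.comp_homeomorph (Homeomorph.subRight x)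

/-- The modulation `e^{iα·} φ` of a compactly supported function. -/
def modulate (φ : CompactlySupportedContinuousMap ℝ ℂ) (α : ℝ) :
    CompactlySupportedContinuousMap ℝ ℂ where
  toFun y := Complex.exp (Complex.I * α * y) * φ y
  continuous_toFun := by fun_prop
  hasCompactSupport' := φ.hasCompactSupport.mul_left

lemma translate_apply (φ : CompactlySupportedContinuousMap ℝ ℂ) (x y : ℝ) :
    translate φ x y = φ (y - x) := rfl

lemma modulate_apply (φ : CompactlySupportedContinuousMap ℝ ℂ) (α y : ℝ) :
    modulate φ α y = Complex.exp (Complex.I * α * y) * φ y := rfl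

lemma ae_eq_comp_sub {u v : ℝ → ℂ} (h : u =ᵐ[volume] v) (x : ℝ) :
    (fun y => u (y - x)) =ᵐ[volume] fun y => v (y - x) :=
  (measurePreserving_sub_right volume x).quasiMeasurePreserving.ae_eq_comp h

lemma S_ofCc (φ : CompactlySupportedContinuousMap ℝ ℂ) (x : ℝ) :
    P.S x (P.ofCc φ) = P.ofCc (translate φ x) :=
  P.eq_ofCc ((P.S_spec x _).trans (ae_eq_comp_sub (P.ofCc_spec φ) x))

lemma T_ofCc (φ : CompactlySupportedContinuousMap ℝ ℂ) (α : ℝ) :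
    P.T α (P.ofCc φ) = P.ofCc (modulate φ α) := by
  apply P.eq_ofCc
  filter_upwards [P.T_spec α (P.ofCc φ), P.ofCc_spec φ] with x h1 h2
  rw [h1, h2, modulate_apply]

open scoped Pointwise in
lemma continuous_S (f : H) : Continuous fun x => P.S x f := by
  refine continuous_apply_of_dense P.ofCc_dense (fun x₀ => ?_) ?_ f
  · obtain ⟨C, hC⟩ := P.S_loc_bdd (Metric.closedBall x₀ 1) (isCompact_closedBall _ _)
    exact ⟨C, Filter.eventually_of_mem (Metric.closedBall_mem_nhds x₀ one_pos) hC⟩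
  · rintro _ ⟨φ, rfl⟩
    simp only [S_ofCc]
    refine continuous_iff_continuousAt.2 fun x₀ => ?_
    refine P.continuousAt_ofCc (K := tsupport φ + Metric.closedBall x₀ 1) ?_ ?_ ?_
    · simp only [translate_apply]; fun_prop
    · exact φ.hasCompactSupport.isCompact.add (isCompact_closedBall _ _)
    · filter_upwards [Metric.closedBall_mem_nhds x₀ one_pos] with x hx y hy
      exact ⟨y - x, subset_tsupport _ hy, x, hx, by simp⟩

lemma continuous_T (f : H) : Continuous fun α => P.T α f := by
  refine continuous_apply_of_dense P.ofCc_dense (fun x₀ => ?_) ?_ f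
  · obtain ⟨C, hC⟩ := P.T_bdd
    exact ⟨C, Filter.Eventually.of_forall hC⟩
  · rintro _ ⟨φ, rfl⟩
    simp only [T_ofCc]
    refine continuous_iff_continuousAt.2 fun x₀ => ?_
    refine P.continuousAt_ofCc (K := tsupport φ) ?_ φ.hasCompactSupport.isCompact ?_
    · simp only [modulate_apply]; fun_prop
    · exact Filter.Eventually.of_forall fun α =>
        (Function.support_mul_subset_right _ _).trans (subset_tsupport _)

/-- Integration against a compactly supported continuous function. -/
def pairing (g : CompactlySupportedContinuousMap ℝ ℂ) : H →L[ℂ] ℂ :=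
  LinearMap.mkContinuousOfExistsBound
    { toFun := fun f => ∫ x, g x * P.ι f x
      map_add' := fun f f' => by
        rw [← integral_add]
        · refine integral_congr_ae ?_
          rw [map_add]
          filter_upwards [AEEqFun.coeFn_add (P.ι f) (P.ι f')] with x hx
          rw [hx, Pi.add_apply, mul_add]
        · exact (P.locInt f).integrable_smul_left_of_hasCompactSupport g.continuous
            g.hasCompactSupport
        · exact (P.locInt f').integrable_smul_left_of_hasCompactSupport g.continuous
            g.hasCompactSupport
      map_smul' := fun c f => by
        rw [RingHom.id_apply, smul_eq_mul, ← integral_const_mul]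
        refine integral_congr_ae ?_
        rw [map_smul]
        filter_upwards [AEEqFun.coeFn_smul c (P.ι f)] with x hx
        rw [hx, Pi.smul_apply, smul_eq_mul, mul_left_comm] } <| by
    obtain ⟨c, hc, -, hK⟩ := P.incl_cont (tsupport g) g.hasCompactSupport.isCompact
    obtain ⟨B, hB⟩ := g.continuous.bounded_above_of_compact_support g.hasCompactSupport
    have hB0 : 0 ≤ B := (norm_nonneg _).trans (hB 0)
    refine ⟨B * c, fun f => ?_⟩
    change ‖∫ x, g x * P.ι f x‖ ≤ _
    have hint := (P.locInt f).integrableOn_isCompact g.hasCompactSupport.isCompact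
    rw [← setIntegral_eq_integral_of_forall_compl_eq_zero (s := tsupport g)
      fun x hx => by rw [image_eq_zero_of_notMem_tsupport hx, zero_mul]]
    calc _ ≤ ∫ x in tsupport g, B * ‖P.ι f x‖ := by
          refine norm_integral_le_of_norm_le (hint.norm.const_mul B) ?_
          refine Filter.Eventually.of_forall fun x => ?_
          rw [norm_mul]
          gcongr
          exact hB x
      _ = B * ∫ x in tsupport g, ‖P.ι f x‖ := integral_const_mul _ _
      _ ≤ B * (c * ‖f‖) := by gcongr; exact hK f
      _ = _ := by ring

lemma pairing_apply (g : CompactlySupportedContinuousMap ℝ ℂ) (f : H) :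
    P.pairing g f = ∫ x, g x * P.ι f x := rfl

lemma ae_eq_of_pairing {f : H} {u : ℝ → ℂ} (hu : LocallyIntegrable u volume)
    (h : ∀ g : CompactlySupportedContinuousMap ℝ ℂ, P.pairing g f = ∫ x, g x * u x) :
    (P.ι f : ℝ → ℂ) =ᵐ[volume] u := by
  refine ae_eq_of_integral_contDiff_smul_eq (P.locInt f) hu fun g hg hgs => ?_
  simp only [Complex.real_smul]
  exact h ⟨⟨fun x => (g x : ℂ), by have := hg.continuous; fun_prop⟩,
    hgs.comp_left Complex.ofReal_zero⟩

lemma continuous_smul_S (χ : CompactlySupportedContinuousMap ℝ ℂ) (f : H) :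
    Continuous fun y => χ y • P.S y f :=
  χ.continuous.smul (P.continuous_S f)

lemma integrable_smul_S (χ : CompactlySupportedContinuousMap ℝ ℂ) (f : H) :
    Integrable fun y => χ y • P.S y f :=
  (P.continuous_smul_S χ f).integrable_of_hasCompactSupport χ.hasCompactSupport.smul_right

lemma norm_integral_smul_S_le (χ : CompactlySupportedContinuousMap ℝ ℂ) {C : ℝ}
    (hC : ∀ y ∈ tsupport χ, ‖P.S y‖ ≤ C) (f : H) :
    ‖∫ y, χ y • P.S y f‖ ≤ (∫ y, ‖χ y‖) * C * ‖f‖ := by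
  have hχ : Integrable χ := χ.continuous.integrable_of_hasCompactSupport χ.hasCompactSupport
  rw [mul_assoc, ← integral_mul_const]
  refine norm_integral_le_of_norm_le (hχ.norm.mul_const _) (Filter.Eventually.of_forall fun y => ?_)
  rw [norm_smul]
  by_cases hy : y ∈ tsupport χ
  · gcongr
    exact (P.S y).le_of_opNorm_le (hC y hy) f
  · simp [image_eq_zero_of_notMem_tsupport hy]

/-- Convolution with a compactly supported continuous function, as an operator on `H`. -/
def conv (χ : CompactlySupportedContinuousMap ℝ ℂ) : H →L[ℂ] H :=
  LinearMap.mkContinuousOfExistsBound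
    { toFun := fun f => ∫ y, χ y • P.S y f
      map_add' := fun f f' => by
        simp only [map_add, smul_add]
        exact integral_add (P.integrable_smul_S χ f) (P.integrable_smul_S χ f')
      map_smul' := fun c f => by
        simp only [map_smul, RingHom.id_apply]
        rw [← integral_smul]
        simp only [smul_comm c] } <| by
    obtain ⟨C, hC⟩ := P.S_loc_bdd _ χ.hasCompactSupport.isCompact
    exact ⟨_, P.norm_integral_smul_S_le χ hC⟩

lemma conv_apply (χ : CompactlySupportedContinuousMap ℝ ℂ) (f : H) :
    P.conv χ f = ∫ y, χ y • P.S y f := rfl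

open scoped Pointwise in
lemma conv_ae (χ : CompactlySupportedContinuousMap ℝ ℂ) (f : H) :
    (P.ι (P.conv χ f) : ℝ → ℂ) =ᵐ[volume]
      MeasureTheory.convolution χ (P.ι f) (ContinuousLinearMap.mul ℂ ℂ) volume := by
  refine P.ae_eq_of_pairing (χ.hasCompactSupport.continuous_convolution_left _ χ.continuous
    (P.locInt f)).locallyIntegrable fun g => ?_
  rw [conv_apply, ← ContinuousLinearMap.integral_comp_comm _ (P.integrable_smul_S χ f)]
  have hint : Integrable (fun p : ℝ × ℝ => g p.1 * (χ p.2 * P.ι f (p.1 - p.2)))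
      (volume.prod volume) := by
    set K : Set ℝ := tsupport g + -tsupport χ
    have hK : IsCompact K := g.hasCompactSupport.isCompact.add χ.hasCompactSupport.isCompact.neg
    obtain ⟨B, hB⟩ := g.continuous.bounded_above_of_compact_support g.hasCompactSupport
    have hχ : Integrable χ := χ.continuous.integrable_of_hasCompactSupport χ.hasCompactSupport
    have h1 := hχ.convolution_integrand (ContinuousLinearMap.mul ℂ ℂ)
      (((P.locInt f).integrableOn_isCompact hK).integrable_indicator hK.measurableSet)
    have h2 := h1.bdd_mul (c := B) (f := fun p : ℝ × ℝ => g p.1)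
      (g.continuous.comp continuous_fst).aestronglyMeasurable
      (Filter.Eventually.of_forall fun p => hB _)
    refine h2.congr (Filter.Eventually.of_forall fun p => ?_)
    simp only [ContinuousLinearMap.mul_apply']
    by_cases h : p.1 - p.2 ∈ K
    · rw [Set.indicator_of_mem h]
    · by_cases hg : p.1 ∈ tsupport g
      · have : p.2 ∉ tsupport χ := fun hχ =>
          h ⟨p.1, hg, -p.2, Set.neg_mem_neg.2 hχ, (sub_eq_add_neg _ _).symm⟩
        simp [image_eq_zero_of_notMem_tsupport this]
      · simp [image_eq_zero_of_notMem_tsupport hg]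
  have hL : ∀ y, P.pairing g (χ y • P.S y f) = ∫ x, g x * (χ y * P.ι f (x - y)) := by
    intro y
    rw [map_smul, pairing_apply, smul_eq_mul, ← integral_const_mul]
    refine integral_congr_ae ?_
    filter_upwards [P.S_spec y f] with x hx
    rw [hx]; ring
  simp only [hL, MeasureTheory.convolution, ContinuousLinearMap.mul_apply', ← integral_const_mul]
  exact (integral_integral_swap hint).symm

lemma conv_ofCc_comm (χ φ : CompactlySupportedContinuousMap ℝ ℂ) :
    P.conv χ (P.ofCc φ) = P.conv φ (P.ofCc χ) := by
  apply P.ext_ae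
  refine (P.conv_ae _ _).trans (Filter.EventuallyEq.trans ?_ (P.conv_ae _ _).symm)
  rw [convolution_congr _ Filter.EventuallyEq.rfl (P.ofCc_spec φ),
    convolution_congr _ Filter.EventuallyEq.rfl (P.ofCc_spec χ)]
  refine Filter.Eventually.of_forall fun x => ?_
  rw [convolution_mul_swap, convolution_mul]
  simp only [mul_comm]

lemma commute_conv {M : H →L[ℂ] H} (hM : ∀ x, M.comp (P.S x) = (P.S x).comp M)
    (χ : CompactlySupportedContinuousMap ℝ ℂ) (f : H) :
    M (P.conv χ f) = P.conv χ (M f) := by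
  rw [conv_apply, conv_apply, ← M.integral_comp_comm (P.integrable_smul_S χ f)]
  congr 1 with y
  rw [map_smul]
  exact congrArg _ (DFunLike.congr_fun (hM y) f)

lemma conv_comp_S (χ : CompactlySupportedContinuousMap ℝ ℂ) (x : ℝ) :
    (P.conv χ).comp (P.S x) = (P.S x).comp (P.conv χ) := by
  ext f
  refine (P.commute_conv (M := P.S x) (fun y => ?_) χ f).symm
  rw [P.S_add, P.S_add, add_comm]

lemma T_zero : P.T 0 = 1 := by
  ext f
  apply P.ext_ae
  filter_upwards [P.T_spec 0 f] with x hx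
  simp [hx]

lemma T_S (α y : ℝ) (f : H) :
    P.T α (P.S y f) = Complex.exp (Complex.I * α * y) • P.S y (P.T α f) := by
  apply P.ext_ae
  rw [map_smul]
  filter_upwards [P.T_spec α (P.S y f), P.S_spec y f, P.S_spec y (P.T α f),
    ae_eq_comp_sub (P.T_spec α f) y, AEEqFun.coeFn_smul (Complex.exp (Complex.I * α * y))
      (P.ι (P.S y (P.T α f)))] with x h1 h2 h3 h4 h5
  rw [h1, h2, h5, Pi.smul_apply, h3, h4, smul_eq_mul, ← mul_assoc, ← Complex.exp_add]
  congr 2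
  push_cast
  ring

lemma T_conv_modulate (α : ℝ) (φ : CompactlySupportedContinuousMap ℝ ℂ) (f : H) :
    P.T α (P.conv (modulate φ (-α)) f) = P.conv φ (P.T α f) := by
  rw [conv_apply, conv_apply, ← (P.T α).integral_comp_comm (P.integrable_smul_S _ f)]
  congr 1 with y
  rw [map_smul, T_S, smul_smul, modulate_apply, mul_right_comm, ← Complex.exp_add]
  simp

lemma continuous_T_apply {u : ℝ → H} (hu : Continuous u) : Continuous fun α => P.T α (u α) := by
  obtain ⟨C, hC⟩ := P.T_bdd
  exact continuous_iff_continuousAt.2 fun α =>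
    tendsto_apply_of_bounded hC hu.continuousAt (P.continuous_T (u α)).continuousAt

lemma integrable_smul_T {k : ℝ → ℂ} (hk : Integrable k) (ε : ℝ) (h : H) :
    Integrable fun β => k β • P.T (ε * β) h := by
  obtain ⟨C, hC⟩ := P.T_bdd
  refine hk.smul_bdd (C * ‖h‖)
    ((P.continuous_T h).comp (continuous_const_mul ε)).aestronglyMeasurable
    (Filter.Eventually.of_forall fun β => (P.T _).le_of_opNorm_le (hC _) h)

lemma integral_smul_T_ae {k ψ : ℝ → ℂ} (hk : Integrable k) (hψ : Continuous ψ)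
    (hkψ : ∀ x : ℝ, ∫ β : ℝ, k β * Complex.exp (Complex.I * β * x) = ψ x) (ε : ℝ) (h : H) :
    (P.ι (∫ β, k β • P.T (ε * β) h) : ℝ → ℂ) =ᵐ[volume] fun x => ψ (ε * x) * P.ι h x := by
  have hψε : Continuous fun x => ψ (ε * x) := by fun_prop
  have hloc : LocallyIntegrable (fun x => ψ (ε * x) * P.ι h x) volume := by
    rw [← locallyIntegrableOn_univ]
    exact ((P.locInt h).locallyIntegrableOn _).continuousOn_smul isOpen_univ.isLocallyClosed
      hψε.continuousOn
  refine P.ae_eq_of_pairing hloc fun g => ?_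
  rw [← ContinuousLinearMap.integral_comp_comm _ (P.integrable_smul_T hk ε h)]
  have hg : Integrable fun x => g x * P.ι h x :=
    (P.locInt h).integrable_smul_left_of_hasCompactSupport g.continuous g.hasCompactSupport
  have hint : Integrable (fun p : ℝ × ℝ =>
      Complex.exp (Complex.I * p.1 * (ε * p.2 : ℝ)) * (k p.1 * (g p.2 * P.ι h p.2)))
      (volume.prod volume) := by
    refine (hk.mul_prod hg).bdd_mul (c := 1) ?_ ?_
    · exact (by fun_prop : Continuous fun p : ℝ × ℝ =>
        Complex.exp (Complex.I * p.1 * (ε * p.2 : ℝ))).aestronglyMeasurable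
    · refine Filter.Eventually.of_forall fun p => ?_
      rw [Complex.norm_exp]
      simp
  have hL : ∀ β, P.pairing g (k β • P.T (ε * β) h) =
      ∫ x, Complex.exp (Complex.I * β * (ε * x : ℝ)) * (k β * (g x * P.ι h x)) := by
    intro β
    rw [map_smul, pairing_apply, smul_eq_mul, ← integral_const_mul]
    refine integral_congr_ae ?_
    filter_upwards [P.T_spec (ε * β) h] with x hx
    rw [hx, show Complex.I * ((ε * β : ℝ) : ℂ) * x = Complex.I * β * (ε * x : ℝ) by
      push_cast; ring]
    ring
  simp only [hL]
  rw [integral_integral_swap hint]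
  congr 1 with x
  rw [← hkψ, ← integral_mul_const, ← integral_const_mul]
  congr 1 with β
  ring

lemma norm_conj_le {A : H →L[ℂ] H} {C D : ℝ} (hA : ‖A‖ ≤ C) (hD : ∀ α, ‖P.T α‖ ≤ D) (α : ℝ)
    (f : H) : ‖P.T α (A (P.T (-α) f))‖ ≤ D * (C * (D * ‖f‖)) := by
  have hC0 : 0 ≤ C := (norm_nonneg _).trans hA
  have hD0 : 0 ≤ D := (norm_nonneg _).trans (hD 0)
  refine ((P.T α).le_of_opNorm_le (hD α) _).trans ?_
  gcongr
  refine (A.le_of_opNorm_le hA _).trans ?_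
  gcongr
  exact (P.T _).le_of_opNorm_le (hD _) f

lemma integrable_smul_conj {k : ℝ → ℂ} (hk : Integrable k) (ε : ℝ) (A : H →L[ℂ] H) (f : H) :
    Integrable fun β => k β • P.T (ε * β) (A (P.T (-(ε * β)) f)) := by
  obtain ⟨D, hD⟩ := P.T_bdd
  have hc : Continuous fun α => P.T α (A (P.T (-α) f)) :=
    P.continuous_T_apply (A.continuous.comp ((P.continuous_T f).comp continuous_neg))
  exact hk.smul_bdd (D * (‖A‖ * (D * ‖f‖))) (hc.comp (continuous_const_mul ε)).aestronglyMeasurable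
    (Filter.Eventually.of_forall fun β => P.norm_conj_le le_rfl hD _ f)

lemma norm_integral_smul_conj_le {k : ℝ → ℂ} (hk : Integrable k) (ε : ℝ) (A : H →L[ℂ] H) {D : ℝ}
    (hD : ∀ α, ‖P.T α‖ ≤ D) (f : H) :
    ‖∫ β, k β • P.T (ε * β) (A (P.T (-(ε * β)) f))‖ ≤ (∫ β, ‖k β‖) * D * ‖A‖ * D * ‖f‖ := by
  rw [show (∫ β, ‖k β‖) * D * ‖A‖ * D * ‖f‖ = (∫ β, ‖k β‖) * (D * (‖A‖ * (D * ‖f‖))) by ring,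
    ← integral_mul_const]
  refine norm_integral_le_of_norm_le (hk.norm.mul_const _) (Filter.Eventually.of_forall fun β => ?_)
  rw [norm_smul]
  gcongr
  exact P.norm_conj_le le_rfl hD _ f

/-- The weighted average `∫ k(β) T_{εβ} A T_{-εβ} dβ` of the modulation conjugates of `A`. -/
def average {k : ℝ → ℂ} (hk : Integrable k) (ε : ℝ) (A : H →L[ℂ] H) : H →L[ℂ] H :=
  have hint := fun f => P.integrable_smul_conj hk ε A f
  LinearMap.mkContinuousOfExistsBound
    { toFun := fun f => ∫ β, k β • P.T (ε * β) (A (P.T (-(ε * β)) f))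
      map_add' := fun f f' => by
        simp only [map_add, smul_add]
        exact integral_add (hint f) (hint f')
      map_smul' := fun c f => by
        simp only [map_smul, RingHom.id_apply]
        rw [← integral_smul]
        simp only [smul_comm c] } <| by
    obtain ⟨C, hC⟩ := P.T_bdd
    exact ⟨_, P.norm_integral_smul_conj_le hk ε A hC⟩

lemma average_apply {k : ℝ → ℂ} (hk : Integrable k) (ε : ℝ) (A : H →L[ℂ] H) (f : H) :
    P.average hk ε A f = ∫ β, k β • P.T (ε * β) (A (P.T (-(ε * β)) f)) := rfl

lemma average_ofCc {k : ℝ → ℂ} (hk : Integrable k) (ε : ℝ) {M : H →L[ℂ] H}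
    (hM : ∀ x, M.comp (P.S x) = (P.S x).comp M) (χ φ : CompactlySupportedContinuousMap ℝ ℂ) :
    P.average hk ε (M.comp (P.conv χ)) (P.ofCc φ) =
      P.conv φ (∫ β, k β • P.T (ε * β) (M (P.ofCc χ))) := by
  rw [average_apply, ← (P.conv φ).integral_comp_comm (P.integrable_smul_T hk ε _)]
  congr 1 with β
  rw [map_smul, T_ofCc, ContinuousLinearMap.comp_apply, conv_ofCc_comm, P.commute_conv hM,
    T_conv_modulate]

lemma exists_conv_eq_ofCc {k ψ : ℝ → ℂ} (hk : Integrable k) (hψ : Continuous ψ)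
    (hψc : HasCompactSupport ψ)
    (hkψ : ∀ x : ℝ, ∫ β : ℝ, k β * Complex.exp (Complex.I * β * x) = ψ x) {ε : ℝ} (hε : ε ≠ 0)
    (χ : CompactlySupportedContinuousMap ℝ ℂ) (h : H) :
    ∃ φ, P.conv χ (∫ β, k β • P.T (ε * β) h) = P.ofCc φ := by
  have hae := P.integral_smul_T_ae hk hψ hkψ ε h
  have hψε : HasCompactSupport fun x => ψ (ε * x) :=
    hψc.comp_homeomorph (Homeomorph.mulLeft₀ ε hε)
  refine ⟨⟨⟨MeasureTheory.convolution χ (P.ι (∫ β, k β • P.T (ε * β) h))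
    (ContinuousLinearMap.mul ℂ ℂ) volume, ?_⟩, ?_⟩, P.eq_ofCc (P.conv_ae _ _)⟩
  · exact χ.hasCompactSupport.continuous_convolution_left _ χ.continuous (P.locInt _)
  · change HasCompactSupport (MeasureTheory.convolution _ _ _ _)
    rw [convolution_congr _ Filter.EventuallyEq.rfl hae]
    exact χ.hasCompactSupport.convolution _ hψε.mul_right

lemma exists_conv_eq_comp_average {k ψ : ℝ → ℂ} (hk : Integrable k) (hψ : Continuous ψ)
    (hψc : HasCompactSupport ψ)
    (hkψ : ∀ x : ℝ, ∫ β : ℝ, k β * Complex.exp (Complex.I * β * x) = ψ x) {ε : ℝ} (hε : ε ≠ 0)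
    {M : H →L[ℂ] H} (hM : ∀ x, M.comp (P.S x) = (P.S x).comp M)
    (χ : CompactlySupportedContinuousMap ℝ ℂ) :
    ∃ φ, P.conv φ = (P.conv χ).comp (P.average hk ε (M.comp (P.conv χ))) := by
  obtain ⟨φ, hφ⟩ := P.exists_conv_eq_ofCc hk hψ hψc hkψ hε χ (M (P.ofCc χ))
  refine ⟨φ, DFunLike.coe_injective <| P.ofCc_dense.equalizer
    (ContinuousLinearMap.continuous _) (ContinuousLinearMap.continuous _) ?_⟩
  ext1 θ
  simp only [Function.comp_apply, ContinuousLinearMap.comp_apply]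
  rw [P.average_ofCc hk ε hM, P.commute_conv (P.conv_comp_S χ), hφ, conv_ofCc_comm]

lemma exists_approximate_identity :
    ∃ (χ : ℕ → CompactlySupportedContinuousMap ℝ ℂ) (C : ℝ), (∀ n, ‖P.conv (χ n)‖ ≤ C) ∧
      ∀ f, Tendsto (fun n => P.conv (χ n) f) atTop (𝓝 f) := by
  let b : ℕ → ContDiffBump (0 : ℝ) := fun n =>
    ⟨1 / (n + 2), 1 / (n + 1), by positivity, by gcongr; norm_num⟩
  let χ : ℕ → CompactlySupportedContinuousMap ℝ ℂ := fun n =>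
    ⟨⟨fun x => ((b n).normed volume x : ℂ),
        by have := (b n).continuous_normed (μ := volume); fun_prop⟩,
      (b n).hasCompactSupport_normed.comp_left Complex.ofReal_zero⟩
  have hχ : ∀ n x, χ n x = ((b n).normed volume x : ℂ) := fun n x => rfl
  obtain ⟨C, hC⟩ := P.S_loc_bdd (Metric.closedBall 0 1) (isCompact_closedBall _ _)
  have hC0 : 0 ≤ C := (norm_nonneg _).trans (hC 0 (by simp))
  refine ⟨χ, C, fun n => ?_, fun f => ?_⟩
  · refine ContinuousLinearMap.opNorm_le_bound _ hC0 fun f => ?_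
    have hsupp : tsupport (χ n) ⊆ Metric.closedBall 0 1 := by
      refine (closure_mono (Function.support_comp_subset Complex.ofReal_zero _)).trans ?_
      refine ((b n).tsupport_normed_eq (μ := volume)).subset.trans
        (Metric.closedBall_subset_closedBall ?_)
      change (1 : ℝ) / (n + 1) ≤ 1
      rw [div_le_one (by positivity)]
      linarith [(Nat.cast_nonneg n : (0 : ℝ) ≤ n)]
    have h1 : ∫ y, ‖χ n y‖ = 1 := by
      rw [← (b n).integral_normed (μ := volume)]
      congr 1 with y
      rw [hχ, Complex.norm_real, Real.norm_of_nonneg ((b n).nonneg_normed y)]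
    have h2 := P.norm_integral_smul_S_le (χ n) (fun y hy => hC y (hsupp hy)) f
    rwa [h1, one_mul] at h2
  · have hb : Tendsto (fun n => (b n).rOut) atTop (𝓝 0) :=
      tendsto_one_div_add_atTop_nhds_zero_nat
    have := ContDiffBump.convolution_tendsto_right_of_continuous (μ := volume) hb
      ((P.continuous_S f).comp continuous_neg) 0
    simp only [MeasureTheory.convolution, Function.comp_apply, zero_sub, neg_neg, neg_zero,
      P.S_zero, ContinuousLinearMap.lsmul_apply] at this
    refine this.congr fun n => ?_
    rw [conv_apply]
    congr 1 with y

lemma tendsto_average {k : ℝ → ℂ} (hk : Integrable k) (hk1 : ∫ β, k β = 1) {ε : ℕ → ℝ}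
    (hε : Tendsto ε atTop (𝓝 0)) {A : ℕ → H →L[ℂ] H} {C : ℝ} (hA : ∀ n, ‖A n‖ ≤ C) {f g : H}
    (hAf : Tendsto (fun n => A n f) atTop (𝓝 g)) :
    Tendsto (fun n => P.average hk (ε n) (A n) f) atTop (𝓝 g) := by
  obtain ⟨D, hD⟩ := P.T_bdd
  have hC0 : 0 ≤ C := (norm_nonneg _).trans (hA 0)
  have hD0 : 0 ≤ D := (norm_nonneg _).trans (hD 0)
  have hg : g = ∫ β, k β • g := by rw [integral_smul_const, hk1, one_smul]
  rw [hg]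
  simp only [average_apply]
  refine tendsto_integral_of_dominated_convergence (fun β => ‖k β‖ * (D * (C * (D * ‖f‖))))
    (fun n => (P.integrable_smul_conj hk (ε n) (A n) f).aestronglyMeasurable)
    (hk.norm.mul_const _) (fun n => Filter.Eventually.of_forall fun β => ?_)
    (Filter.Eventually.of_forall fun β => ?_)
  · rw [norm_smul]
    gcongr
    exact P.norm_conj_le (hA n) hD _ f
  · have hεβ : Tendsto (fun n => ε n * β) atTop (𝓝 0) := by simpa using hε.mul_const β
    have hT : ∀ {u : ℕ → ℝ} (f : H), Tendsto u atTop (𝓝 0) →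
        Tendsto (fun n => P.T (u n) f) atTop (𝓝 f) := fun f hu => by
      have h0 := (P.continuous_T f).tendsto 0
      rw [P.T_zero] at h0
      exact h0.comp hu
    refine Tendsto.const_smul ?_ (k β)
    refine tendsto_apply_of_bounded (fun n => hD _) ?_ (hT g hεβ)
    exact tendsto_apply_of_bounded hA (hT f (by simpa using hεβ.neg)) hAf

end MultiplierSetup

lemma exists_integrable_compactSupport_fourier :
    ∃ k ψ : ℝ → ℂ, Integrable k ∧ Continuous ψ ∧ HasCompactSupport ψ ∧ ∫ β, k β = 1 ∧
      ∀ x : ℝ, ∫ β : ℝ, k β * Complex.exp (Complex.I * β * x) = ψ x := by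
  let b : ContDiffBump (0 : ℝ) := ⟨1, 2, one_pos, one_lt_two⟩
  have hbc : HasCompactSupport fun x => (b x : ℂ) :=
    b.hasCompactSupport.comp_left Complex.ofReal_zero
  let s : SchwartzMap ℝ ℂ := hbc.toSchwartzMap (Complex.ofRealCLM.contDiff.comp b.contDiff)
  have hs : ∀ x, s x = (b x : ℂ) := fun x => rfl
  have hπ : (2 * π)⁻¹ ≠ 0 := by positivity
  have hinv : ∀ x : ℝ, ∫ β : ℝ, FourierTransform.fourier s β *
      Complex.exp (Complex.I * β * x) = b ((2 * π)⁻¹ * x) := by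
    intro x
    have h := congrArg (fun u : SchwartzMap ℝ ℂ => u ((2 * π)⁻¹ * x))
      (FourierTransform.fourierInv_fourier_eq (F := SchwartzMap ℝ ℂ) s)
    rw [SchwartzMap.fourierInv_coe, Real.fourierInv_eq', hs] at h
    rw [← h]
    congr 1 with β
    rw [smul_eq_mul, mul_comm]
    congr 2
    have : (2 * π * inner ℝ β ((2 * π)⁻¹ * x) : ℝ) = β * x := by
      simp only [RCLike.inner_apply, conj_trivial]
      field_simp
    rw [this]
    push_cast
    ring
  refine ⟨FourierTransform.fourier s, fun x => (b ((2 * π)⁻¹ * x) : ℂ), SchwartzMap.integrable _,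
    ?_, hbc.comp_homeomorph (Homeomorph.mulLeft₀ _ hπ), ?_, hinv⟩
  · have := b.continuous
    fun_prop
  · have h0 := hinv 0
    simp only [Complex.ofReal_zero, mul_zero, Complex.exp_zero, mul_one] at h0
    rw [h0, b.one_of_mem_closedBall (by simp [b]), Complex.ofReal_one]

/-- **Theorem 3.** There is a constant `C > 0`, depending only on `H`, such that every
multiplier `M` on `H` is the strong limit of a sequence of convolution operators
`M_{φ_n}` with `φ_n ∈ C_c(ℝ)` and `‖M_{φ_n}‖ ≤ C ‖M‖`. -/
theorem multiplier_approx_by_convolutions {H : Type} [NormedAddCommGroup H]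
    [InnerProductSpace ℂ H] [CompleteSpace H] (P : MultiplierSetup H) :
    ∃ C > 0, ∀ M : H →L[ℂ] H, (∀ x : ℝ, M.comp (P.S x) = (P.S x).comp M) →
      ∃ (φ : ℕ → CompactlySupportedContinuousMap ℝ ℂ) (N : ℕ → H →L[ℂ] H),
        (∀ (n : ℕ) (f : H), (P.ι (N n f) : ℝ → ℂ) =ᵐ[volume]
          fun x => ∫ y : ℝ, (P.ι f : ℝ → ℂ) (x - y) * φ n y) ∧
        (∀ f : H, Filter.Tendsto (fun n => ‖N n f - M f‖) Filter.atTop (nhds 0)) ∧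
        (∀ n : ℕ, ‖N n‖ ≤ C * ‖M‖) := by
  obtain ⟨k, ψ, hk, hψ, hψc, hk1, hkψ⟩ := exists_integrable_compactSupport_fourier
  obtain ⟨χ, B, hB, hχ⟩ := P.exists_approximate_identity
  obtain ⟨D, hD⟩ := P.T_bdd
  have hB0 : 0 ≤ B := (norm_nonneg _).trans (hB 0)
  have hD0 : 0 ≤ D := (norm_nonneg _).trans (hD 0)
  have hI0 : 0 ≤ ∫ β, ‖k β‖ := integral_nonneg fun β => norm_nonneg _
  refine ⟨B * ((∫ β, ‖k β‖) * D * B * D) + 1, by positivity, fun M hM => ?_⟩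
  choose φ hφ using fun n : ℕ => P.exists_conv_eq_comp_average hk hψ hψc hkψ
    (Nat.one_div_pos_of_nat (α := ℝ) (n := n)).ne' hM (χ n)
  have hMχ : ∀ n, ‖M.comp (P.conv (χ n))‖ ≤ ‖M‖ * B := fun n =>
    (M.opNorm_comp_le _).trans (by gcongr; exact hB n)
  refine ⟨φ, fun n => P.conv (φ n), fun n f => ?_, fun f => ?_, fun n => ?_⟩
  · refine (P.conv_ae (φ n) f).trans (Filter.Eventually.of_forall fun x => ?_)
    simp only [MeasureTheory.convolution, ContinuousLinearMap.mul_apply', mul_comm]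
  · rw [← tendsto_iff_norm_sub_tendsto_zero]
    simp only [hφ, ContinuousLinearMap.comp_apply]
    refine tendsto_apply_of_bounded hB ?_ (hχ (M f))
    exact P.tendsto_average hk hk1 tendsto_one_div_add_atTop_nhds_zero_nat hMχ
      ((M.continuous.tendsto f).comp (hχ f))
  · beta_reduce
    rw [hφ]
    refine (ContinuousLinearMap.opNorm_comp_le _ _).trans ?_
    have h1 : ‖P.average hk (1 / ((n : ℝ) + 1)) (M.comp (P.conv (χ n)))‖ ≤
        (∫ β, ‖k β‖) * D * (‖M‖ * B) * D := by
      refine ContinuousLinearMap.opNorm_le_bound _ (by positivity) fun f => ?_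
      refine (P.norm_integral_smul_conj_le hk _ _ hD f).trans ?_
      gcongr
      exact hMχ n
    calc _ ≤ B * ((∫ β, ‖k β‖) * D * (‖M‖ * B) * D) := by gcongr; exact hB n
      _ = B * ((∫ β, ‖k β‖) * D * B * D) * ‖M‖ := by ring
      _ ≤ _ := by gcongr; linarith
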